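/- Let g ≥ 1 and H = ℤ^{1+2g} with basis x, y_1,…,y_{2g}; write y = y_1. For an integer a ≥ 1 let p_a = 1 + Σ_{i=1}^{a} y^{i−1}(y−1)x^i ∈ ℤ[H]. Then: (i) p_a is irreducible in ℤ[H]; (ii) p_a ≁ p̄_a (in particular p_a ≐̸ p̄_a); (iii) for a ≠ b, p_a ≁ p_b and p̄_a ≁ p_b. (Example 5.5 together with the claims used in the proof of Theorem 6.4.) -/

import Mathlib

noncomputable section
open scoped nonZeroDivisors

/-- `H = H₁(Σ_{g,2}) ≅ ℤ^{1+2g}`, written as `H_∂ × Ĥ` with `H_∂ = ℤ` (one basis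
element `x`) and `Ĥ = ℤ^{2g}` carrying the symplectic structure. -/
abbrev SurfH (g : ℕ) : Type := (Fin 1 → ℤ) × ((Fin g → ℤ) × (Fin g → ℤ))

/-- The integral group ring `ℤ[H]`. -/
abbrev GR (g : ℕ) : Type := AddMonoidAlgebra ℤ (SurfH g)

/-- The standard symplectic form on `Ĥ = ℤ^{2g}`. -/
def symplForm {g : ℕ} (v w : (Fin g → ℤ) × (Fin g → ℤ)) : ℤ :=
  (∑ i, v.1 i * w.2 i) - ∑ i, v.2 i * w.1 i

/-- `Aut*(H)`: automorphisms of `H` fixing `H_∂` pointwise and with block form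
`[[1, *], [0, P₀]]`, `P₀ ∈ Sp(2g, ℤ)`. -/
def AutStar (g : ℕ) : Set (SurfH g ≃+ SurfH g) :=
  {φ | (∀ x : Fin 1 → ℤ, φ (x, 0) = (x, 0)) ∧
       ∀ v w : (Fin g → ℤ) × (Fin g → ℤ),
         symplForm (φ (0, v)).2 (φ (0, w)).2 = symplForm v w}

/-- The ring automorphism of `ℤ[H]` induced by an automorphism of `H`. -/
def ringAut {g : ℕ} (φ : SurfH g ≃+ SurfH g) : GR g ≃+* GR g :=
  (AddMonoidAlgebra.domCongr ℤ ℤ φ).toRingEquiv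

/-- The involution `p ↦ p̄` of `ℤ[H]`, induced by `h ↦ h⁻¹`. -/
def barR (g : ℕ) : GR g ≃+* GR g := ringAut (AddEquiv.neg (SurfH g))

/-- `p ≐ q`: `p = ±h·q` for some `h ∈ H`. -/
def doteqR {g : ℕ} (p q : GR g) : Prop :=
  ∃ (u : ℤˣ) (h : SurfH g), p = AddMonoidAlgebra.single h (u : ℤ) * q

/-- `p ∼ q`: `p ≐ φ(q)` for some `φ ∈ Aut*(H)`. -/
def simR (g : ℕ) (p q : GR g) : Prop :=
  ∃ φ ∈ AutStar g, doteqR p (ringAut φ q)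

/-- The boundary basis element `x ∈ H`. -/
def xElt (g : ℕ) : SurfH g := (fun _ => 1, 0)

/-- The symplectic basis element `y = y₁ ∈ H`. -/
def yElt (g : ℕ) (hg : 0 < g) : SurfH g := (0, (Pi.single ⟨0, hg⟩ 1, 0))

/-- `p_a = 1 + Σ_{i=1}^{a} y^{i-1}(y-1)x^i ∈ ℤ[H]`. -/
def pPoly (g : ℕ) (hg : 0 < g) (a : ℕ) : GR g :=
  1 + ∑ i ∈ Finset.range a,
      (AddMonoidAlgebra.single (yElt g hg) 1) ^ i *
        ((AddMonoidAlgebra.single (yElt g hg) 1) - 1) *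
        (AddMonoidAlgebra.single (xElt g) 1) ^ (i + 1)

namespace Polynomial

/-- A polynomial with equal degree and trailing degree is a monomial. -/
theorem eq_monomial_of_natDegree_le_natTrailingDegree {R : Type*} [Semiring R]
    {F : R[X]} (h : F.natDegree ≤ F.natTrailingDegree) :
    F = monomial F.natDegree F.leadingCoeff := by
  ext k
  rw [coeff_monomial]
  split_ifs with hk
  · rw [← hk, leadingCoeff]
  · rcases lt_or_gt_of_ne hk with hk | hk
    · exact coeff_eq_zero_of_natDegree_lt hk
    · exact coeff_eq_zero_of_lt_natTrailingDegree (hk.trans_le h)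

end Polynomial

namespace LaurentPolynomial

open Polynomial

variable {R : Type*} [CommRing R] {A B : R}

theorem natDegree_linear_mul_X_pow [IsDomain R] (hB : B ≠ 0) (N : ℕ) :
    ((Polynomial.C A + Polynomial.C B * X) * X ^ N).natDegree = N + 1 := by
  have h : (Polynomial.C A + Polynomial.C B * X).natDegree = 1 := by
    rw [add_comm]; exact natDegree_linear hB
  have h0 : Polynomial.C A + Polynomial.C B * X ≠ 0 := by
    intro h0; simp [h0] at h
  rw [natDegree_mul_X_pow N h0, h, add_comm]

theorem natTrailingDegree_linear_mul_X_pow (hA : A ≠ 0) (N : ℕ) :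
    ((Polynomial.C A + Polynomial.C B * X) * X ^ N).natTrailingDegree = N := by
  have hc : (Polynomial.C A + Polynomial.C B * X).coeff 0 = A := by simp
  have h0 : Polynomial.C A + Polynomial.C B * X ≠ 0 := by
    intro h0; rw [h0] at hc; exact hA (by simpa using hc.symm)
  have h : (Polynomial.C A + Polynomial.C B * X).natTrailingDegree = 0 :=
    Nat.le_zero.1 (natTrailingDegree_le_of_ne_zero (by rwa [hc]))
  rw [natTrailingDegree_mul_X_pow h0, h, zero_add]

theorem isUnit_of_monomial_mul_eq (hAB : IsCoprime A B) {r : R} {k N : ℕ} {Q : R[X]}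
    (h : monomial k r * Q = (Polynomial.C A + Polynomial.C B * X) * X ^ N) : IsUnit r := by
  have hdvd : ∀ j, r ∣ ((Polynomial.C A + Polynomial.C B * X) * X ^ N).coeff j := by
    intro j
    rw [← h, ← C_mul_X_pow_eq_monomial, mul_assoc, coeff_C_mul]
    exact dvd_mul_right _ _
  refine hAB.isUnit_of_dvd' ?_ ?_
  · simpa [coeff_mul_X_pow'] using hdvd N
  · simpa [coeff_mul_X_pow', coeff_C] using hdvd (N + 1)

theorem isUnit_of_toLaurent_monomial {f : R[T;T⁻¹]} {r : R} {n k : ℕ} (hr : IsUnit r)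
    (h : toLaurent (monomial k r) = f * T n) : IsUnit f := by
  have h1 : IsUnit (f * T n) := by
    rw [← h, ← C_mul_X_pow_eq_monomial, toLaurent_C_mul_X_pow]
    exact (hr.map C).mul (isUnit_T _)
  exact isUnit_of_mul_isUnit_left h1

/-- A Laurent polynomial `A + B T` over a domain with `A`, `B` nonzero and comaximal is
irreducible. -/
theorem irreducible_C_add_C_mul_T [IsDomain R] (hA : A ≠ 0) (hB : B ≠ 0) (hAB : IsCoprime A B) :
    Irreducible (C A + C B * T 1 : R[T;T⁻¹]) := by
  have key : ∀ (N : ℕ), toLaurent ((Polynomial.C A + Polynomial.C B * X) * X ^ N) =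
      (C A + C B * T 1) * T N := by
    intro N; simp
  have hne : ∀ N : ℕ, (Polynomial.C A + Polynomial.C B * X) * X ^ N ≠ 0 := by
    intro N h0
    have := natDegree_linear_mul_X_pow (A := A) hB N
    simp [h0] at this
  constructor
  · intro hu
    obtain ⟨v, hv⟩ := hu.exists_right_inv
    obtain ⟨m, V, hV⟩ := exists_T_pow v
    have h : (Polynomial.C A + Polynomial.C B * X) * X ^ 0 * V = X ^ m := by
      apply toLaurent_injective
      rw [map_mul, key, hV, toLaurent_X_pow]
      calc _ = ((C A + C B * T 1) * v) * T m := by simp [mul_assoc]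
        _ = _ := by rw [hv, one_mul]
    have hV0 : V ≠ 0 := by
      rintro rfl; simp at h; exact pow_ne_zero m X_ne_zero h.symm
    have h1 := congrArg natDegree h
    have h2 := congrArg natTrailingDegree h
    rw [natDegree_mul (hne 0) hV0, natDegree_linear_mul_X_pow hB, natDegree_X_pow] at h1
    rw [natTrailingDegree_mul (hne 0) hV0, natTrailingDegree_linear_mul_X_pow hA,
      natTrailingDegree_X_pow] at h2
    have := natTrailingDegree_le_natDegree V
    omega
  · intro f q hfq
    obtain ⟨n, F, hF⟩ := exists_T_pow f
    obtain ⟨m, Q, hQ⟩ := exists_T_pow q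
    have h : F * Q = (Polynomial.C A + Polynomial.C B * X) * X ^ (n + m) := by
      apply toLaurent_injective
      rw [map_mul, key, hF, hQ, hfq, Nat.cast_add, T_add]
      ring
    have hFQ : F * Q ≠ 0 := h ▸ hne _
    have hF0 := left_ne_zero_of_mul hFQ
    have hQ0 := right_ne_zero_of_mul hFQ
    have h1 := congrArg natDegree h
    have h2 := congrArg natTrailingDegree h
    rw [natDegree_mul hF0 hQ0, natDegree_linear_mul_X_pow hB] at h1
    rw [natTrailingDegree_mul hF0 hQ0, natTrailingDegree_linear_mul_X_pow hA] at h2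
    have hF1 := natTrailingDegree_le_natDegree F
    have hQ1 := natTrailingDegree_le_natDegree Q
    rcases (by omega : F.natDegree ≤ F.natTrailingDegree ∨ Q.natDegree ≤ Q.natTrailingDegree)
      with hw | hw
    · have e := eq_monomial_of_natDegree_le_natTrailingDegree hw
      rw [e] at h hF
      exact .inl (isUnit_of_toLaurent_monomial (isUnit_of_monomial_mul_eq hAB h) hF)
    · have e := eq_monomial_of_natDegree_le_natTrailingDegree hw
      rw [mul_comm, e] at h
      rw [e] at hQ
      exact .inr (isUnit_of_toLaurent_monomial (isUnit_of_monomial_mul_eq hAB h) hQ)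

end LaurentPolynomial

section GroupRing

open LaurentPolynomial

variable {H : Type*} [AddCommGroup H]

/-- The embedding `ℤ[H] → ℤ[H][T;T⁻¹]`, `h ↦ h T^{ℓ(h)}`, recording the grading of `ℤ[H]`
by a homomorphism `ℓ : H → ℤ`. -/
def gradingHom (l : H →+ ℤ) :
    AddMonoidAlgebra ℤ H →ₐ[ℤ] LaurentPolynomial (AddMonoidAlgebra ℤ H) :=
  AddMonoidAlgebra.lift ℤ _ H
    { toFun := fun h => C (AddMonoidAlgebra.single h.toAdd 1) * T (l h.toAdd)
      map_one' := by simp [← AddMonoidAlgebra.one_def]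
      map_mul' := fun h k => by
        have : (AddMonoidAlgebra.single (h.toAdd + k.toAdd) 1 : AddMonoidAlgebra ℤ H) =
            AddMonoidAlgebra.single h.toAdd 1 * AddMonoidAlgebra.single k.toAdd 1 := by
          simp [AddMonoidAlgebra.single_mul_single]
        rw [toAdd_mul, map_add, T_add, this, map_mul]
        ring }

theorem gradingHom_single (l : H →+ ℤ) (h : H) :
    gradingHom l (AddMonoidAlgebra.single h 1) = C (AddMonoidAlgebra.single h 1) * T (l h) := by
  simp [gradingHom]

theorem isLocalHom_gradingHom (l : H →+ ℤ) : IsLocalHom (gradingHom l) := by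
  let e : LaurentPolynomial (AddMonoidAlgebra ℤ H) →+* AddMonoidAlgebra ℤ H :=
    LaurentPolynomial.eval₂ (RingHom.id _) 1
  have he : e.toIntAlgHom.comp (gradingHom l) = AlgHom.id ℤ _ := by
    refine AddMonoidAlgebra.algHom_ext (fun h => ?_) (Subsingleton.elim _ _)
    change e (gradingHom l (AddMonoidAlgebra.single h 1)) = AddMonoidAlgebra.single h 1
    rw [gradingHom_single, LaurentPolynomial.eval₂_C_mul_T]
    simp
  refine ⟨fun f hf => ?_⟩
  have := hf.map e
  have h2 : e (gradingHom l f) = f := DFunLike.congr_fun he f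
  rwa [h2] at this

/-- The augmentation `ℤ[H] → ℤ`. -/
def augmentation (H : Type*) [AddCommGroup H] : AddMonoidAlgebra ℤ H →ₐ[ℤ] ℤ :=
  AddMonoidAlgebra.lift ℤ ℤ H 1

@[simp]
theorem augmentation_single (h : H) (n : ℤ) :
    augmentation H (AddMonoidAlgebra.single h n) = n := by
  simp [augmentation]

end GroupRing

section SurfaceGroupRing

open AddMonoidAlgebra

variable {g : ℕ}

theorem augmentation_ringAut (φ : SurfH g ≃+ SurfH g) (q : GR g) :
    augmentation (SurfH g) (ringAut φ q) = augmentation (SurfH g) q := by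
  have : (augmentation (SurfH g)).comp (domCongr ℤ ℤ φ : GR g →ₐ[ℤ] GR g) =
      augmentation (SurfH g) := by
    refine AddMonoidAlgebra.algHom_ext (fun h => ?_) (Subsingleton.elim _ _)
    simp
  exact DFunLike.congr_fun this q

theorem coeff_ringAut (φ : SurfH g ≃+ SurfH g) (q : GR g) (k : SurfH g) :
    (ringAut φ q).coeff k = q.coeff (φ.symm k) := by
  simp [ringAut]

theorem card_support_ringAut (φ : SurfH g ≃+ SurfH g) (q : GR g) :
    (ringAut φ q).coeff.support.card = q.coeff.support.card := by
  have : (ringAut φ q).coeff.support = q.coeff.support.map φ := domCongr_support (R := ℤ) φ q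
  rw [this, Finset.card_map]

theorem card_support_of_doteqR {p q : GR g} (h : doteqR p q) :
    p.coeff.support.card = q.coeff.support.card := by
  obtain ⟨u, k, rfl⟩ := h
  have : (single k (u : ℤ) * q).coeff.support =
      q.coeff.support.map (Equiv.addLeft k).toEmbedding := by
    ext m
    simp [coeff_single_mul_apply, Finset.mem_map_equiv]
  rw [this, Finset.card_map]

theorem card_support_of_simR {p q : GR g} (h : simR g p q) :
    p.coeff.support.card = q.coeff.support.card := by
  obtain ⟨φ, -, h⟩ := h
  rw [card_support_of_doteqR h, card_support_ringAut]

theorem simR_of_doteqR {p q : GR g} (h : doteqR p q) : simR g p q := by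
  refine ⟨AddEquiv.refl _, ⟨fun _ => rfl, fun _ _ => rfl⟩, ?_⟩
  have : ringAut (AddEquiv.refl (SurfH g)) q = q := by
    ext k; simp [coeff_ringAut]
  rwa [this]

/-- The homomorphism `H → ℤ` with `x ↦ 1`, `y ↦ -1`, killing the other basis elements. -/
def level (g : ℕ) (hg : 0 < g) : SurfH g →+ ℤ where
  toFun h := h.1 0 - h.2.1 ⟨0, hg⟩
  map_zero' := by simp
  map_add' h k := by simp; ring

@[simp]
theorem level_xElt (hg : 0 < g) : level g hg (xElt g) = 1 := by
  simp [level, xElt]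

@[simp]
theorem level_yElt (hg : 0 < g) : level g hg (yElt g hg) = -1 := by
  simp [level, yElt]

/-- The element `z = xy` of `H`. -/
def zElt (g : ℕ) (hg : 0 < g) : SurfH g := xElt g + yElt g hg

@[simp]
theorem level_zElt (hg : 0 < g) : level g hg (zElt g hg) = 0 := by
  simp [zElt]

theorem nsmul_zElt_injective (hg : 0 < g) :
    Function.Injective fun j : ℕ => j • zElt g hg := by
  intro i j h
  have := congrFun (congrArg Prod.fst h) 0
  simpa [zElt, xElt, yElt] using this

theorem xElt_add_nsmul_zElt_injective (hg : 0 < g) :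
    Function.Injective fun j : ℕ => xElt g + j • zElt g hg :=
  (add_right_injective _).comp (nsmul_zElt_injective hg)

/-- The exponents of `p_a` with coefficient `1`: the powers `z^j`, `j ≤ a`. -/
def posExps (g : ℕ) (hg : 0 < g) (a : ℕ) : Finset (SurfH g) :=
  (Finset.range (a + 1)).image fun j => j • zElt g hg

/-- The exponents of `p_a` with coefficient `-1`: the monomials `x z^j`, `j < a`. -/
def negExps (g : ℕ) (hg : 0 < g) (a : ℕ) : Finset (SurfH g) :=
  (Finset.range a).image fun j => xElt g + j • zElt g hg

theorem level_of_mem_posExps {hg : 0 < g} {a : ℕ} {k : SurfH g} (hk : k ∈ posExps g hg a) :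
    level g hg k = 0 := by
  obtain ⟨j, -, rfl⟩ := Finset.mem_image.1 hk
  simp [-nsmul_eq_mul]

theorem level_of_mem_negExps {hg : 0 < g} {a : ℕ} {k : SurfH g} (hk : k ∈ negExps g hg a) :
    level g hg k = 1 := by
  obtain ⟨j, -, rfl⟩ := Finset.mem_image.1 hk
  simp [-nsmul_eq_mul]

theorem card_posExps (hg : 0 < g) (a : ℕ) : (posExps g hg a).card = a + 1 := by
  rw [posExps, Finset.card_image_of_injective _ (nsmul_zElt_injective hg), Finset.card_range]

theorem card_negExps (hg : 0 < g) (a : ℕ) : (negExps g hg a).card = a := by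
  rw [negExps, Finset.card_image_of_injective _
    (xElt_add_nsmul_zElt_injective hg), Finset.card_range]

theorem pPoly_eq_sum (hg : 0 < g) (a : ℕ) :
    pPoly g hg a = ∑ k ∈ posExps g hg a, single k 1 - ∑ k ∈ negExps g hg a, single k 1 := by
  rw [posExps, negExps, Finset.sum_image (nsmul_zElt_injective hg).injOn,
    Finset.sum_image (xElt_add_nsmul_zElt_injective hg).injOn,
    Finset.sum_range_succ', add_sub_right_comm, ← Finset.sum_sub_distrib, pPoly, add_comm,
    zero_smul, ← one_def]
  congr 1
  refine Finset.sum_congr rfl fun i _ => ?_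
  rw [mul_sub, sub_mul, ← pow_succ, mul_one]
  simp only [single_pow, single_mul_single, one_pow, mul_one, zElt]
  congr 2
  · rw [smul_add, add_comm]
  · rw [smul_add, succ_nsmul]; abel

theorem coeff_pPoly (hg : 0 < g) (a : ℕ) (k : SurfH g) :
    (pPoly g hg a).coeff k =
      (if k ∈ posExps g hg a then 1 else 0) - (if k ∈ negExps g hg a then 1 else 0) := by
  rw [pPoly_eq_sum]
  simp [Finsupp.single_apply]

theorem card_support_pPoly (hg : 0 < g) (a : ℕ) :
    (pPoly g hg a).coeff.support.card = 2 * a + 1 := by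
  have hd : ∀ k, k ∈ posExps g hg a → k ∉ negExps g hg a := fun k h1 h2 => by
    have := level_of_mem_posExps h1
    rw [level_of_mem_negExps h2] at this
    exact one_ne_zero this
  have : (pPoly g hg a).coeff.support = posExps g hg a ∪ negExps g hg a := by
    ext k
    rw [Finsupp.mem_support_iff, coeff_pPoly, Finset.mem_union]
    have := hd k
    split_ifs <;> simp_all
  rw [this, Finset.card_union_of_disjoint (Finset.disjoint_left.2 hd), card_posExps,
    card_negExps]
  ring

theorem level_of_coeff_pPoly_eq_one {hg : 0 < g} {a : ℕ} {k : SurfH g}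
    (h : (pPoly g hg a).coeff k = 1) : level g hg k = 0 := by
  by_cases hk : k ∈ posExps g hg a
  · exact level_of_mem_posExps hk
  · rw [coeff_pPoly, if_neg hk] at h
    split_ifs at h <;> simp at h

theorem level_of_coeff_pPoly_eq_neg_one {hg : 0 < g} {a : ℕ} {k : SurfH g}
    (h : (pPoly g hg a).coeff k = -1) : level g hg k = 1 := by
  by_cases hk : k ∈ negExps g hg a
  · exact level_of_mem_negExps hk
  · rw [coeff_pPoly, if_neg hk] at h
    split_ifs at h <;> simp at h

theorem coeff_pPoly_zero (hg : 0 < g) (a : ℕ) : (pPoly g hg a).coeff 0 = 1 := by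
  have h1 : (0 : SurfH g) ∈ posExps g hg a := Finset.mem_image.2 ⟨0, by simp, by simp⟩
  have h2 : (0 : SurfH g) ∉ negExps g hg a := fun h => by simpa using level_of_mem_negExps h
  rw [coeff_pPoly, if_pos h1, if_neg h2, sub_zero]

theorem coeff_pPoly_xElt (hg : 0 < g) {a : ℕ} (ha : 1 ≤ a) :
    (pPoly g hg a).coeff (xElt g) = -1 := by
  have h1 : xElt g ∉ posExps g hg a := fun h => by simpa using level_of_mem_posExps h
  have h2 : xElt g ∈ negExps g hg a :=
    Finset.mem_image.2 ⟨0, Finset.mem_range.2 ha, by simp⟩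
  rw [coeff_pPoly, if_neg h1, if_pos h2, zero_sub]

theorem augmentation_pPoly (hg : 0 < g) (a : ℕ) :
    augmentation (SurfH g) (pPoly g hg a) = 1 := by
  simp [pPoly_eq_sum, card_posExps, card_negExps]

theorem irreducible_pPoly (hg : 0 < g) {a : ℕ} (ha : 1 ≤ a) : Irreducible (pPoly g hg a) := by
  set A : GR g := ∑ k ∈ posExps g hg a, single k 1 with hA
  set B : GR g := -∑ k ∈ negExps g hg a, single k 1 with hB
  have hA0 : A ≠ 0 := fun h => by
    have := congrArg (augmentation (SurfH g)) h
    simp [hA, card_posExps] at this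
    omega
  have hB0 : B ≠ 0 := fun h => by
    have := congrArg (augmentation (SurfH g)) h
    simp [hB, card_negExps] at this
    omega
  have hAB : IsCoprime A B := by
    refine ⟨1, single (yElt g hg) 1, ?_⟩
    rw [hA, hB, posExps, negExps, Finset.sum_image (nsmul_zElt_injective hg).injOn,
      Finset.sum_image (xElt_add_nsmul_zElt_injective hg).injOn,
      Finset.sum_range_succ', mul_neg, Finset.mul_sum, one_mul, zero_smul, ← one_def]
    have : ∀ i : ℕ, (single (yElt g hg) 1 * single (xElt g + i • zElt g hg) 1 : GR g) =
        single ((i + 1) • zElt g hg) 1 := by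
      intro i
      rw [single_mul_single, mul_one, succ_nsmul, zElt]
      congr 1
      abel
    simp only [this]
    abel
  have := isLocalHom_gradingHom (level g hg)
  refine Irreducible.of_map (f := gradingHom (level g hg)) ?_
  have hp : gradingHom (level g hg) (pPoly g hg a) =
      LaurentPolynomial.C A + LaurentPolynomial.C B * LaurentPolynomial.T 1 := by
    have hP : gradingHom (level g hg) (∑ k ∈ posExps g hg a, single k 1) =
        LaurentPolynomial.C (∑ k ∈ posExps g hg a, single k 1) := by
      rw [map_sum, map_sum]
      exact Finset.sum_congr rfl fun k hk => by
        rw [gradingHom_single, level_of_mem_posExps hk, LaurentPolynomial.T_zero, mul_one]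
    have hN : gradingHom (level g hg) (∑ k ∈ negExps g hg a, single k 1) =
        LaurentPolynomial.C (∑ k ∈ negExps g hg a, single k 1) * LaurentPolynomial.T 1 := by
      rw [map_sum, map_sum, Finset.sum_mul]
      exact Finset.sum_congr rfl fun k hk => by
        rw [gradingHom_single, level_of_mem_negExps hk]
    rw [pPoly_eq_sum, map_sub, hP, hN, hA, hB, map_neg]
    ring
  rw [hp]
  exact LaurentPolynomial.irreducible_C_add_C_mul_T hA0 hB0 hAB

theorem not_simR_pPoly_barR (hg : 0 < g) {a : ℕ} (ha : 1 ≤ a) :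
    ¬ simR g (pPoly g hg a) (barR g (pPoly g hg a)) := by
  rintro ⟨φ, ⟨hφ, -⟩, u, h, e⟩
  have hu : (u : ℤ) = 1 := by
    have := congrArg (augmentation (SurfH g)) e
    rw [map_mul, augmentation_ringAut, barR, augmentation_ringAut, augmentation_pPoly,
      augmentation_single, mul_one] at this
    exact this.symm
  have hx : φ.symm (xElt g) = xElt g := by
    rw [AddEquiv.symm_apply_eq]
    exact (hφ _).symm
  have hc : ∀ k, (pPoly g hg a).coeff k = (pPoly g hg a).coeff (-φ.symm (-h + k)) := by
    intro k
    conv_lhs => rw [e]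
    rw [coeff_single_mul_apply, hu, one_mul, coeff_ringAut, barR, coeff_ringAut]
    simp
  have h1 : level g hg h = 0 := level_of_coeff_pPoly_eq_one (a := a) <| by
    rw [hc]; simp [coeff_pPoly_zero]
  have h2 : level g hg (h - xElt g) = 1 := level_of_coeff_pPoly_eq_neg_one (a := a) <| by
    have hx' : -φ.symm (-h + (h - xElt g)) = xElt g := by
      rw [neg_add_eq_sub, sub_sub_cancel_left, map_neg φ.symm, neg_neg, hx]
    rw [hc, hx', coeff_pPoly_xElt hg ha]
  simp [h1] at h2

end SurfaceGroupRing

/-- **Example 5.5 together with the claims used in the proof of Theorem 6.4.**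
For `g ≥ 1` and `a ≥ 1`: `p_a` is irreducible, `p_a ≁ p̄_a` (in particular
`p_a ≐̸ p̄_a`), and for `a ≠ b` one has `p_a ≁ p_b` and `p̄_a ≁ p_b`. -/
theorem pPoly_irreducible_non_self_dual_distinct
    (g : ℕ) (hg : 0 < g) (a b : ℕ) (ha : 1 ≤ a) (hb : 1 ≤ b) :
    Irreducible (pPoly g hg a) ∧
    ¬ simR g (pPoly g hg a) (barR g (pPoly g hg a)) ∧
    ¬ doteqR (pPoly g hg a) (barR g (pPoly g hg a)) ∧
    (a ≠ b →
      ¬ simR g (pPoly g hg a) (pPoly g hg b) ∧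
      ¬ simR g (barR g (pPoly g hg a)) (pPoly g hg b)) := by
  refine ⟨irreducible_pPoly hg ha, not_simR_pPoly_barR hg ha,
    fun h => not_simR_pPoly_barR hg ha (simR_of_doteqR h), fun hab => ⟨fun h => ?_, fun h => ?_⟩⟩
  · have := card_support_of_simR h
    rw [card_support_pPoly, card_support_pPoly] at this
    omega
  · have := card_support_of_simR h
    rw [barR, card_support_ringAut, card_support_pPoly, card_support_pPoly] at this
    omega
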